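/- Let p₁, …, p_N ∈ ℝⁿ be points whose convex hull Δ = conv{p₁,…,p_N} has nonempty interior containing the origin, and suppose Δ = {y ∈ ℝⁿ : ⟨v_r, y⟩ ≥ -1 for r = 1,…,K} for vectors v₁,…,v_K ∈ ℝⁿ. Let u₀(x) = log(Σ_α e^{⟨p_α, x⟩}) + c₀ where c₀ is chosen so that ∫_{ℝⁿ} e^{-u₀} dx = vol(Δ), and assume ∇u₀(ℝⁿ) = int Δ. Let P_c = (∫_Δ y dy)/vol(Δ). Suppose (t_i) is a sequence in (0,1) converging to T ∈ (0,1), and for each i there is a smooth function u_i : ℝⁿ → ℝ with positive-definite Hessian, ∇u_i(ℝⁿ) = int Δ, and det(D²u_i) = e^{-w_i} where w_i = (1-t_i)u₀ + t_i u_i; let x_i be the point where w_i attains its minimum. Suppose ‖x_i‖ → ∞ and ∇u₀(x_i) → y_∞. Then y_∞ lies in the frontier of Δ, and for every r = 1,…,K one has ⟨v_r, -(T/(1-T))·P_c⟩ ≥ -1, with equality if and only if ⟨v_r, y_∞⟩ = -1. In particular -(T/(1-T))·P_c lies in the frontier of Δ, on exactly the same faces as y_∞. -/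

import Mathlib

open MeasureTheory Set Filter
open scoped RealInnerProductSpace Topology

/-- A symmetric operator bounded below by the identity has determinant at least one. -/
lemma Matrix.one_le_det_one_add_of_posSemidef {n : Type*} [Fintype n] [DecidableEq n]
    {P : Matrix n n ℝ} (hP : P.PosSemidef) : 1 ≤ (1 + P).det := by
  have hH : (1 + P).IsHermitian := Matrix.isHermitian_one.add hP.1
  rw [hH.det_eq_prod_eigenvalues]
  refine Finset.one_le_prod fun i => ?_
  have h1 := hH.eigenvalues_eq i
  set v := hH.eigenvectorBasis i
  have h2 : ‖v‖ = 1 := hH.eigenvectorBasis.orthonormal.1 i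
  have h3 : star (v : n → ℝ) ⬝ᵥ (v : n → ℝ) = 1 := by
    have := real_inner_self_eq_norm_sq v
    rw [h2, EuclideanSpace.inner_eq_star_dotProduct] at this
    simpa using this
  have h4 := hP.dotProduct_mulVec_nonneg (v : n → ℝ)
  rw [Matrix.add_mulVec, dotProduct_add, Matrix.one_mulVec, h3] at h1
  have h5 : (1 : ℝ) ≤ hH.eigenvalues i := by
    rw [h1]
    simpa using h4
  simpa using h5

/-- The determinant is monotone on positive semidefinite matrices. -/
lemma Matrix.PosSemidef.det_le_det_add {n : Type*} [Fintype n] [DecidableEq n]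
    {A B : Matrix n n ℝ} (hA : A.PosSemidef) (hB : B.PosSemidef) : A.det ≤ (A + B).det := by
  by_cases hdet : A.det = 0
  · rw [hdet]
    exact (hA.add hB).det_nonneg
  open scoped MatrixOrder in
  obtain ⟨C, hC⟩ := CStarAlgebra.nonneg_iff_eq_star_mul_self.mp hA.nonneg
  have hCdet : IsUnit C.det := by
    rw [isUnit_iff_ne_zero]
    rintro h
    apply hdet
    rw [hC, Matrix.det_mul, h, mul_zero]
  have key : A + B = C.conjTranspose * (1 + (C⁻¹).conjTranspose * B * C⁻¹) * C := by
    have e1 : C⁻¹ * C = 1 := Matrix.nonsing_inv_mul _ hCdet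
    have e2 : C.conjTranspose * (C⁻¹).conjTranspose = 1 := by
      rw [← Matrix.conjTranspose_mul, e1, Matrix.conjTranspose_one]
    calc A + B = C.conjTranspose * C
          + (C.conjTranspose * (C⁻¹).conjTranspose) * B * (C⁻¹ * C) := by
          rw [e1, e2, hC]; simp [Matrix.star_eq_conjTranspose]
      _ = _ := by noncomm_ring
  have h1 := Matrix.one_le_det_one_add_of_posSemidef (hB.conjTranspose_mul_mul_same C⁻¹)
  have h2 : A.det = C.det * C.det := by
    rw [hC, Matrix.det_mul, Matrix.star_eq_conjTranspose, Matrix.det_conjTranspose]; simp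
  rw [key, Matrix.det_mul, Matrix.det_mul, Matrix.det_conjTranspose, h2, star_trivial]
  nlinarith [mul_self_nonneg C.det]

/-- The determinant is monotone on positive operators. -/
lemma LinearMap.IsPositive.det_le_det_add {E : Type*} [NormedAddCommGroup E]
    [InnerProductSpace ℝ E] [FiniteDimensional ℝ E] {A B : E →ₗ[ℝ] E}
    (hA : A.IsPositive) (hB : B.IsPositive) : LinearMap.det A ≤ LinearMap.det (A + B) := by
  let b := stdOrthonormalBasis ℝ E
  rw [← LinearMap.det_toMatrix b.toBasis, ← LinearMap.det_toMatrix b.toBasis, map_add]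
  exact ((LinearMap.posSemidef_toMatrix_iff b).2 hA).det_le_det_add
    ((LinearMap.posSemidef_toMatrix_iff b).2 hB)

section GradientOfConvex

variable {E : Type*} [NormedAddCommGroup E] [InnerProductSpace ℝ E] [CompleteSpace E]
  {g : E → ℝ}

lemma ContDiff.contDiff_gradient (hg : ContDiff ℝ 2 g) : ContDiff ℝ 1 (gradient g) :=
  (InnerProductSpace.toDual ℝ E).symm.contDiff.comp (hg.fderiv_right (by norm_num))

lemma ContDiff.hasFDerivAt_gradient (hg : ContDiff ℝ 2 g) (x : E) :
    HasFDerivAt (gradient g) (fderiv ℝ (gradient g) x) x :=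
  (hg.contDiff_gradient.differentiable (by norm_num) x).hasFDerivAt

lemma ContDiff.isSymmetric_fderiv_gradient (hg : ContDiff ℝ 2 g) (x : E) :
    (fderiv ℝ (gradient g) x).toLinearMap.IsSymmetric := by
  have key : ∀ a b, ⟪fderiv ℝ (gradient g) x a, b⟫ = fderiv ℝ (fderiv ℝ g) x a b := by
    intro a b
    have h1 : HasFDerivAt (fun y => InnerProductSpace.toDual ℝ E (gradient g y))
        ((InnerProductSpace.toDual ℝ E).toContinuousLinearEquiv.toContinuousLinearMap.comp
          (fderiv ℝ (gradient g) x)) x :=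
      (InnerProductSpace.toDual ℝ E).toContinuousLinearEquiv.toContinuousLinearMap.hasFDerivAt.comp
        x (hg.hasFDerivAt_gradient x)
    simp only [toDual_gradient] at h1
    rw [h1.fderiv]
    simp
  intro a b
  have hs := hg.contDiffAt.isSymmSndFDerivAt (x := x) (by simp) a b
  change ⟪fderiv ℝ (gradient g) x a, b⟫ = ⟪a, fderiv ℝ (gradient g) x b⟫
  rw [key, real_inner_comm, key, hs]

lemma hasDerivAt_inner_gradient_line (hg : ContDiff ℝ 2 g) (x h : E) (s : ℝ) :
    HasDerivAt (fun s : ℝ => ⟪gradient g (x + s • h), h⟫)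
      ⟪fderiv ℝ (gradient g) (x + s • h) h, h⟫ s := by
  have h1 : HasDerivAt (fun s : ℝ => x + s • h) h s := by
    simpa using ((hasDerivAt_id s).smul_const h).const_add x
  simpa using ((hg.hasFDerivAt_gradient _).comp_hasDerivAt s h1).inner ℝ (hasDerivAt_const s h)

lemma hasDerivAt_line (hg : ContDiff ℝ 2 g) (x h : E) (s : ℝ) :
    HasDerivAt (fun s : ℝ => g (x + s • h)) ⟪gradient g (x + s • h), h⟫ s := by
  have h1 : HasDerivAt (fun s : ℝ => x + s • h) h s := by
    simpa using ((hasDerivAt_id s).smul_const h).const_add x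
  have h2 := (hg.differentiable (by norm_num) (x + s • h)).hasFDerivAt.comp_hasDerivAt s h1
  rwa [inner_gradient_left]

/-- A function with positive definite Hessian has strictly monotone gradient. -/
lemma inner_gradient_sub_pos (hg : ContDiff ℝ 2 g)
    (hpos : ∀ x h, h ≠ 0 → 0 < ⟪fderiv ℝ (gradient g) x h, h⟫) {x y : E} (hxy : x ≠ y) :
    0 < ⟪gradient g y - gradient g x, y - x⟫ := by
  have hm : StrictMono (fun s : ℝ => ⟪gradient g (x + s • (y - x)), y - x⟫) := by
    apply strictMono_of_hasDerivAt_pos (hasDerivAt_inner_gradient_line hg x (y - x))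
    exact fun s => hpos _ _ (sub_ne_zero.2 hxy.symm)
  have := hm zero_lt_one
  simp only [zero_smul, add_zero, one_smul, add_sub_cancel] at this
  rw [inner_sub_left]
  linarith

lemma gradient_injective (hg : ContDiff ℝ 2 g)
    (hpos : ∀ x h, h ≠ 0 → 0 < ⟪fderiv ℝ (gradient g) x h, h⟫) :
    Function.Injective (gradient g) := by
  intro x y hxy
  by_contra hne
  have := inner_gradient_sub_pos hg hpos hne
  simp [hxy] at this

/-- A function with positive semidefinite Hessian lies above its tangent hyperplanes. -/
lemma add_inner_gradient_le (hg : ContDiff ℝ 2 g)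
    (hpos : ∀ x h, 0 ≤ ⟪fderiv ℝ (gradient g) x h, h⟫) (x y : E) :
    g x + ⟪gradient g x, y - x⟫ ≤ g y := by
  have hm : Monotone (fun s : ℝ => ⟪gradient g (x + s • (y - x)), y - x⟫) := by
    apply monotone_of_hasDerivAt_nonneg (hasDerivAt_inner_gradient_line hg x (y - x))
    exact fun s => hpos _ _
  obtain ⟨c, hc, hc'⟩ := exists_hasDerivAt_eq_slope (fun s : ℝ => g (x + s • (y - x)))
    (fun s : ℝ => ⟪gradient g (x + s • (y - x)), y - x⟫) zero_lt_one
    (fun s _ => (hasDerivAt_line hg x (y - x) s).continuousAt.continuousWithinAt)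
    (fun s _ => hasDerivAt_line hg x (y - x) s)
  have := hm hc.1.le
  simp only [zero_smul, add_zero, one_smul, add_sub_cancel, sub_zero, div_one] at this hc'
  linarith

/-- If `g` lies above its tangent hyperplanes, its Hessian is positive semidefinite. -/
lemma inner_fderiv_gradient_nonneg (hg : ContDiff ℝ 2 g)
    (htan : ∀ x y, g x + ⟪gradient g x, y - x⟫ ≤ g y) (x h : E) :
    0 ≤ ⟪fderiv ℝ (gradient g) x h, h⟫ := by
  have hm : Monotone (fun s : ℝ => ⟪gradient g (x + s • h), h⟫) := by
    intro a b hab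
    rcases hab.eq_or_lt with rfl | hab
    · rfl
    have h1 := htan (x + a • h) (x + b • h)
    have h2 := htan (x + b • h) (x + a • h)
    rw [add_sub_add_left_eq_sub, ← sub_smul, inner_smul_right] at h1 h2
    have : 0 ≤ (b - a) * (⟪gradient g (x + b • h), h⟫ - ⟪gradient g (x + a • h), h⟫) := by
      linarith
    simpa using nonneg_of_mul_nonneg_right this (sub_pos.2 hab)
  have h0 := (hasDerivAt_inner_gradient_line hg x h 0).deriv
  have := hm.deriv_nonneg (x := 0)
  rw [h0] at this
  simpa using this

end GradientOfConvex

section Volume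

variable {n : ℕ}

lemma det_toEuclideanLin (M : Matrix (Fin n) (Fin n) ℝ) :
    LinearMap.det (Matrix.toEuclideanLin M) = M.det := by
  rw [show Matrix.toEuclideanLin M = Matrix.toLpLin 2 2 M from rfl, Matrix.toLpLin_eq_toLin,
    LinearMap.det_toLin]

/-- The cube with centre at the origin and side length `2 (n + 1)`. -/
def coordinateCube (n : ℕ) : Set (EuclideanSpace ℝ (Fin n)) := {x | ∀ j, |x j| ≤ n + 1}

lemma volume_coordinateCube_lt_top : volume (coordinateCube n) < ⊤ := by
  have hsub : coordinateCube n ⊆ Metric.closedBall 0 (√(∑ _j : Fin n, ((n : ℝ) + 1) ^ 2)) := by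
    intro x hx
    rw [mem_closedBall_zero_iff, EuclideanSpace.norm_eq]
    gcongr with j
    exact hx j
  exact (measure_mono hsub).trans_lt measure_closedBall_lt_top

lemma exists_maximal_simplex {A : Set (EuclideanSpace ℝ (Fin n))} (hA : IsCompact A)
    (hint : (interior A).Nonempty) :
    ∃ s₀ ∈ A, ∃ s : Fin n → EuclideanSpace ℝ (Fin n), (∀ j, s j ∈ A) ∧
      (Matrix.of fun i j => (s j - s₀) i).det ≠ 0 ∧
      ∀ s' : Fin n → EuclideanSpace ℝ (Fin n), (∀ j, s' j ∈ A) →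
        |(Matrix.of fun i j => (s' j - s₀) i).det| ≤
          |(Matrix.of fun i j => (s j - s₀) i).det| := by
  let F : EuclideanSpace ℝ (Fin n) × (Fin n → EuclideanSpace ℝ (Fin n)) → ℝ :=
    fun q => |(Matrix.of fun i j => (q.2 j - q.1) i).det|
  have hF : Continuous F := by
    refine (Continuous.matrix_det ?_).abs
    refine continuous_matrix fun i j => ?_
    simp only [Matrix.of_apply]
    fun_prop
  have hK : IsCompact (A ×ˢ (Set.univ.pi fun _ : Fin n => A)) :=
    hA.prod (isCompact_univ_pi fun _ => hA)
  obtain ⟨a, ha⟩ := hint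
  obtain ⟨r, hr, hrA⟩ := Metric.isOpen_iff.1 isOpen_interior a ha
  have haA := interior_subset ha
  obtain ⟨q, hq, hmax⟩ := hK.exists_isMaxOn ⟨(a, fun _ => a), haA, fun _ _ => haA⟩ hF.continuousOn
  refine ⟨q.1, hq.1, q.2, fun j => hq.2 j trivial, ?_, fun s' hmem => ?_⟩
  · have h1 : F (a, fun j => a + EuclideanSpace.single j (r / 2)) ≤ F q := by
      refine hmax ⟨haA, fun j _ => interior_subset (hrA ?_)⟩
      simp [abs_of_pos hr, hr]
    have h2 : (Matrix.of fun i j : Fin n =>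
        ((a + EuclideanSpace.single j (r / 2)) - a) i) = (r / 2) • (1 : Matrix _ _ ℝ) := by
      ext i j
      simp [Matrix.one_apply]
    simp only [F] at h1
    rw [h2, Matrix.det_smul] at h1
    intro h0
    rw [h0] at h1
    have h3 : 0 < |r / 2| ^ n := by positivity
    simp only [Matrix.det_one, mul_one, Fintype.card_fin, abs_pow, abs_zero] at h1
    linarith
  · exact hmax (a := (q.1, s')) ⟨hq.1, fun j _ => hmem j⟩

/-- A weak form of the Blaschke–Santaló inequality: with respect to a suitable centre, the product
of the volumes of a convex body and its polar body is bounded by a dimensional constant. -/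
lemma exists_volume_mul_volume_polar_le {A : Set (EuclideanSpace ℝ (Fin n))} (hA : IsCompact A)
    (hconv : Convex ℝ A) (hint : (interior A).Nonempty) :
    ∃ c ∈ A, volume A * volume {y | ∀ z ∈ A, ⟪y, z - c⟫ ≤ 1} ≤ volume (coordinateCube n) ^ 2 := by
  obtain ⟨s₀, hs₀, s, hs, hdet, hmax⟩ := exists_maximal_simplex hA hint
  set M : Matrix (Fin n) (Fin n) ℝ := Matrix.of fun i j => (s j - s₀) i with hM
  have hn1 : (0 : ℝ) < n + 1 := by positivity
  set S : EuclideanSpace ℝ (Fin n) := (n + 1 : ℝ)⁻¹ • ∑ j, (s j - s₀) with hS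
  have hcA : s₀ + S ∈ A := by
    have h1 := hconv.sum_mem (t := Finset.univ) (w := fun _ : Option (Fin n) => (n + 1 : ℝ)⁻¹)
      (z := fun o => o.elim s₀ s) (fun _ _ => by positivity) (by simp; field_simp)
      (by rintro (_ | j) _; exacts [hs₀, hs j])
    convert h1 using 1
    simp only [Fintype.sum_option, Option.elim_none, Option.elim_some, hS, Finset.sum_sub_distrib,
      ← Finset.smul_sum]
    rw [smul_sub, Finset.sum_const, Finset.card_univ, Fintype.card_fin, ← Nat.cast_smul_eq_nsmul ℝ,
      smul_smul]
    have : (n + 1 : ℝ)⁻¹ * n = 1 - (n + 1 : ℝ)⁻¹ := by field_simp; ring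
    rw [this, sub_smul, one_smul, smul_add]
    abel
  refine ⟨s₀ + S, hcA, ?_⟩
  have hvolA : volume A ≤ ENNReal.ofReal |M.det| * volume (coordinateCube n) := by
    have hsub : A ⊆ (fun z => s₀ + z) '' (Matrix.toEuclideanLin M '' coordinateCube n) := by
      intro z hz
      refine ⟨z - s₀, ⟨WithLp.toLp 2 (M.det⁻¹ • M.cramer (z - s₀)), fun j => ?_, ?_⟩, by simp⟩
      · have h1 := hmax (Function.update s j z) (by
          intro k
          by_cases hk : k = j
          · subst hk; simpa using hz
          · simpa [hk] using hs k)
        have h2 : (Matrix.of fun i k => (Function.update s j z k - s₀) i)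
            = M.updateCol j (z - s₀) := by
          ext i k
          by_cases hk : k = j
          · subst hk; simp
          · simp [hk, hM]
        rw [h2, ← Matrix.cramer_apply] at h1
        simp only [Pi.smul_apply, smul_eq_mul, abs_mul, abs_inv]
        have : |M.det|⁻¹ * |M.cramer (z - s₀) j| ≤ 1 := by
          rw [inv_mul_le_iff₀ (abs_pos.2 hdet)]; simpa using h1
        have hn0 : (0 : ℝ) ≤ n := by positivity
        exact this.trans (by linarith)
      · rw [Matrix.toLpLin_toLp, Matrix.toLin'_apply, Matrix.mulVec_smul, Matrix.mulVec_cramer, smul_smul,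
          inv_mul_cancel₀ hdet, one_smul]
        simp
    calc volume A ≤ _ := measure_mono hsub
      _ = _ := by
        rw [image_add_left, measure_preimage_add, Measure.addHaar_image_linearMap,
          det_toEuclideanLin]
  have hvolP : volume {y | ∀ z ∈ A, ⟪y, z - (s₀ + S)⟫ ≤ 1} ≤
      ENNReal.ofReal |M.det⁻¹| * volume (coordinateCube n) := by
    have hsub : {y | ∀ z ∈ A, ⟪y, z - (s₀ + S)⟫ ≤ 1} ⊆
        Matrix.toEuclideanLin M.transpose ⁻¹' coordinateCube n := by
      intro y hy j
      have e1 : ∀ j, (Matrix.toEuclideanLin M.transpose y) j = ⟪y, s j - s₀⟫ := by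
        intro j
        rw [PiLp.inner_apply]
        simp [Matrix.toLpLin_apply, Matrix.mulVec, dotProduct, hM]
      rw [e1]
      have e2 : (n + 1 : ℝ) * ⟪y, S⟫ = ∑ k, ⟪y, s k - s₀⟫ := by
        rw [hS, inner_smul_right, inner_sum, mul_inv_cancel_left₀ hn1.ne']
      have h0 : -⟪y, S⟫ ≤ 1 := by
        have := hy s₀ hs₀
        rwa [sub_add_cancel_left, inner_neg_right] at this
      have h1 : ∀ k, ⟪y, s k - s₀⟫ ≤ 1 + ⟪y, S⟫ := by
        intro k
        have := hy _ (hs k)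
        rw [← sub_sub, inner_sub_right] at this
        linarith
      have h2 : ∑ k, ⟪y, s k - s₀⟫ ≤ n * (1 + ⟪y, S⟫) := by
        simpa [mul_add] using Finset.sum_le_sum fun k (_ : k ∈ Finset.univ) => h1 k
      have h3 : ∑ k, ((1 + ⟪y, S⟫) - ⟪y, s k - s₀⟫) ≥ (1 + ⟪y, S⟫) - ⟪y, s j - s₀⟫ :=
        Finset.single_le_sum (f := fun k => (1 + ⟪y, S⟫) - ⟪y, s k - s₀⟫)
          (fun k _ => sub_nonneg.2 (h1 k)) (Finset.mem_univ j)
      rw [Finset.sum_sub_distrib, ← e2] at h3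
      simp only [Finset.sum_const, Finset.card_univ, Fintype.card_fin, nsmul_eq_mul] at h3
      rw [abs_le]
      have := h1 j
      constructor <;> linarith
    calc volume {y | ∀ z ∈ A, ⟪y, z - (s₀ + S)⟫ ≤ 1} ≤ _ := measure_mono hsub
      _ = _ := by
        rw [Measure.addHaar_preimage_linearMap, det_toEuclideanLin, Matrix.det_transpose]
        rwa [det_toEuclideanLin, Matrix.det_transpose]
  calc _ ≤ (ENNReal.ofReal |M.det| * volume (coordinateCube n)) *
        (ENNReal.ofReal |M.det⁻¹| * volume (coordinateCube n)) := mul_le_mul' hvolA hvolP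
    _ = (ENNReal.ofReal |M.det| * ENNReal.ofReal |M.det⁻¹|) * volume (coordinateCube n) ^ 2 := by
      ring
    _ = _ := by
      rw [← ENNReal.ofReal_mul (abs_nonneg _), ← abs_mul, mul_inv_cancel₀ hdet]
      simp

/-- A convex set which contains a ball and has a large diameter has a large volume. -/
lemma exists_subset_closedBall_of_volume_le {ρ : ℝ} (hρ : 0 < ρ) {C : ENNReal} (hC : C ≠ ⊤) :
    ∃ R : ℝ, ∀ (A : Set (EuclideanSpace ℝ (Fin n))) (x : EuclideanSpace ℝ (Fin n)),
      Convex ℝ A → Metric.ball x ρ ⊆ A → volume A ≤ C → A ⊆ Metric.closedBall x R := by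
  set b : ENNReal := volume (Metric.ball (0 : EuclideanSpace ℝ (Fin n)) (ρ / 2)) with hb
  have hb0 : b ≠ 0 := (Metric.measure_ball_pos _ _ (by positivity)).ne'
  obtain ⟨N, hN⟩ := ENNReal.exists_nat_mul_gt hb0 hC
  refine ⟨2 * N * ρ, fun A x hconv hball hvol z hz => ?_⟩
  by_contra hfar
  rw [Metric.mem_closedBall, dist_eq_norm, not_le] at hfar
  have hzpos : 0 < ‖z - x‖ := lt_of_le_of_lt (by positivity) hfar
  set e : EuclideanSpace ℝ (Fin n) := ‖z - x‖⁻¹ • (z - x) with he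
  have he1 : ‖e‖ = 1 := by
    rw [he, norm_smul, norm_inv, norm_norm, inv_mul_cancel₀ hzpos.ne']
  let B : Fin N → Set (EuclideanSpace ℝ (Fin n)) :=
    fun k => Metric.ball (x + ((k : ℕ) * ρ) • e) (ρ / 2)
  have hBA : ∀ k, B k ⊆ A := by
    intro k y hy
    set θ : ℝ := (k : ℕ) * ρ / ‖z - x‖ with hθ
    have hkN : ((k : ℕ) : ℝ) ≤ N := by exact_mod_cast k.2.le
    have hθ0 : 0 ≤ θ := by positivity
    have hθ1 : θ ≤ 1 / 2 := by
      rw [hθ, div_le_iff₀ hzpos]; nlinarith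
    have h1θ : 0 < 1 - θ := by linarith
    have hθe : ((k : ℕ) * ρ) • e = θ • (z - x) := by
      rw [he, smul_smul, hθ, div_eq_mul_inv]
    set w := y - (x + ((k : ℕ) * ρ) • e) with hw
    have hwn : ‖w‖ < ρ / 2 := by simpa [B, dist_eq_norm] using hy
    have hmem : x + (1 - θ)⁻¹ • w ∈ A := by
      apply hball
      rw [Metric.mem_ball, dist_eq_norm, add_sub_cancel_left, norm_smul, norm_inv,
        Real.norm_of_nonneg h1θ.le, inv_mul_lt_iff₀ h1θ]
      nlinarith
    have := hconv hmem hz h1θ.le hθ0 (by ring)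
    convert this using 1
    rw [smul_add, smul_smul, mul_inv_cancel₀ h1θ.ne', one_smul, hw, hθe, smul_sub, sub_smul,
      one_smul]
    abel
  have hdisj : Pairwise (Function.onFun Disjoint B) := by
    intro k l hkl
    apply Metric.ball_disjoint_ball
    rw [dist_add_left, dist_eq_norm, ← sub_smul, norm_smul, he1, mul_one, ← sub_mul, norm_mul,
      Real.norm_of_nonneg hρ.le]
    have h1 : (1 : ℝ) ≤ ‖((k : ℕ) : ℝ) - ((l : ℕ) : ℝ)‖ := by
      have hne : ((k : ℕ) : ℤ) - ((l : ℕ) : ℤ) ≠ 0 := by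
        intro h; apply hkl; ext; omega
      have := Int.one_le_abs hne
      rw [Real.norm_eq_abs]
      exact_mod_cast this
    nlinarith
  have hvolB : ∀ k, volume (B k) = b := fun k => by
    rw [hb, Measure.addHaar_ball_center]
  have : (N : ENNReal) * b ≤ volume A := by
    calc (N : ENNReal) * b = ∑ k, volume (B k) := by simp [hvolB]
      _ = volume (⋃ k, B k) := by
        rw [measure_iUnion hdisj fun k => Metric.isOpen_ball.measurableSet, tsum_fintype]
      _ ≤ volume A := measure_mono (iUnion_subset hBA)
  exact absurd (this.trans hvol) (not_le.2 hN)

end Volume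

section Tightness

variable {n : ℕ}

lemma convexOn_of_add_inner_gradient_le {E : Type*} [NormedAddCommGroup E] [InnerProductSpace ℝ E]
    [CompleteSpace E] {g : E → ℝ} (htan : ∀ x y, g x + ⟪gradient g x, y - x⟫ ≤ g y) :
    ConvexOn ℝ univ g := by
  refine ⟨convex_univ, fun x _ y _ a b ha hb hab => ?_⟩
  set z := a • x + b • y
  have h1 := mul_le_mul_of_nonneg_left (htan z x) ha
  have h2 := mul_le_mul_of_nonneg_left (htan z y) hb
  have h3 : a * ⟪gradient g z, x - z⟫ + b * ⟪gradient g z, y - z⟫ = 0 := by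
    rw [← inner_smul_right, ← inner_smul_right, ← inner_add_right]
    have : a • (x - z) + b • (y - z) = 0 := by
      have : a • (x - z) + b • (y - z) = z - (a + b) • z := by
        simp only [z, smul_sub, add_smul]; abel
      rw [this, hab, one_smul, sub_self]
    rw [this, inner_zero_right]
  have h4 : (a + b) * g z = g z := by rw [hab, one_mul]
  simp only [smul_eq_mul]
  linarith

/-- For a convex function `w` with minimum at `x₀`, the measure `exp (-w)` gives little mass to the
complement of a large sublevel set. -/
lemma setIntegral_exp_neg_superlevel_le {w : EuclideanSpace ℝ (Fin n) → ℝ}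
    (hcont : Continuous w) (hconv : ConvexOn ℝ univ w) (x₀ : EuclideanSpace ℝ (Fin n))
    (hint : Integrable fun x => Real.exp (-w x)) (s : ℝ) :
    ∫ x in {x | w x₀ + s < w x}, Real.exp (-w x) ≤
      2 ^ n * Real.exp (-s / 2) * ∫ x, Real.exp (-w x) := by
  let G : EuclideanSpace ℝ (Fin n) → ℝ := fun y => Real.exp (-w (y + (1 / 2 : ℝ) • x₀))
  have hG : Integrable G := hint.comp_add_right _
  have hGc : Integrable fun x => G ((1 / 2 : ℝ) • x) := hG.comp_smul (by norm_num)
  have hGint : ∫ x, G ((1 / 2 : ℝ) • x) = 2 ^ n * ∫ x, Real.exp (-w x) := by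
    rw [Measure.integral_comp_smul, finrank_euclideanSpace_fin,
      integral_add_right_eq_self (fun y => Real.exp (-w y))]
    simp
  have hmeas : MeasurableSet {x | w x₀ + s < w x} :=
    (isOpen_lt continuous_const hcont).measurableSet
  calc ∫ x in {x | w x₀ + s < w x}, Real.exp (-w x)
      ≤ ∫ x in {x | w x₀ + s < w x}, Real.exp (-s / 2) * G ((1 / 2 : ℝ) • x) := by
        refine setIntegral_mono_on hint.integrableOn (hGc.const_mul _).integrableOn hmeas ?_
        intro x hx
        have h1 := hconv.2 (mem_univ x) (mem_univ x₀) (show (0 : ℝ) ≤ 1 / 2 by norm_num)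
          (show (0 : ℝ) ≤ 1 / 2 by norm_num) (by norm_num)
        rw [← smul_add] at h1
        simp only [smul_eq_mul, mem_ofPred_eq] at h1 hx
        simp only [G]
        rw [← smul_add]
        rw [← Real.exp_add]
        gcongr
        linarith
    _ ≤ ∫ x, Real.exp (-s / 2) * G ((1 / 2 : ℝ) • x) :=
        setIntegral_le_integral (hGc.const_mul _) (ae_of_all _ fun x => by positivity)
    _ = _ := by rw [integral_const_mul, hGint]; ring

/-- `w` is a convex potential with bounded gradient and minimum at `x₀`, such that `exp (-w)` has
total mass `V` and `w` is a supersolution of the Monge–Ampère equation `det D²w = τ exp (-w)`. -/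
structure IsMongeAmperePotential (τ V d : ℝ) (w : EuclideanSpace ℝ (Fin n) → ℝ)
    (x₀ : EuclideanSpace ℝ (Fin n)) : Prop where
  contDiff : ContDiff ℝ 2 w
  hessian_pos : ∀ x h, h ≠ 0 → 0 < ⟪fderiv ℝ (gradient w) x h, h⟫
  le_det : ∀ x, τ * Real.exp (-w x) ≤ LinearMap.det (fderiv ℝ (gradient w) x).toLinearMap
  isMin : ∀ y, w x₀ ≤ w y
  norm_gradient_le : ∀ x, ‖gradient w x‖ ≤ d
  integrable : Integrable fun x => Real.exp (-w x)
  integral_eq : ∫ x, Real.exp (-w x) = V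

namespace IsMongeAmperePotential

variable {τ V d : ℝ} {w : EuclideanSpace ℝ (Fin n) → ℝ} {x₀ : EuclideanSpace ℝ (Fin n)}

lemma tangent_le (hw : IsMongeAmperePotential τ V d w x₀) (x y : EuclideanSpace ℝ (Fin n)) :
    w x + ⟪gradient w x, y - x⟫ ≤ w y := by
  refine add_inner_gradient_le hw.contDiff (fun x h => ?_) x y
  by_cases hh : h = 0
  · simp [hh]
  · exact (hw.hessian_pos x h hh).le

lemma convexOn (hw : IsMongeAmperePotential τ V d w x₀) : ConvexOn ℝ univ w :=
  convexOn_of_add_inner_gradient_le hw.tangent_le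

lemma convex_sublevel (hw : IsMongeAmperePotential τ V d w x₀) (a : ℝ) : Convex ℝ {x | w x ≤ a} := by
  simpa using hw.convexOn.convex_le a

lemma ball_subset_sublevel (hw : IsMongeAmperePotential τ V d w x₀) (hd : 0 < d) {s : ℝ}
    (hs : 1 ≤ s) : Metric.ball x₀ d⁻¹ ⊆ {x | w x ≤ w x₀ + s} := by
  intro x hx
  rw [Metric.mem_ball, dist_comm, dist_eq_norm] at hx
  have h1 := hw.tangent_le x x₀
  have h2 := (abs_le.1 (abs_real_inner_le_norm (gradient w x) (x₀ - x))).1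
  have h3 : ‖gradient w x‖ * ‖x₀ - x‖ ≤ d * d⁻¹ :=
    mul_le_mul (hw.norm_gradient_le x) hx.le (norm_nonneg _) hd.le
  rw [mul_inv_cancel₀ hd.ne'] at h3
  rw [mem_ofPred_eq]
  linarith

lemma volume_sublevel_lt_top (hw : IsMongeAmperePotential τ V d w x₀) (a : ℝ) :
    volume {x | w x ≤ a} < ⊤ := by
  have h := hw.integrable.measure_ge_lt_top (Real.exp_pos (-a))
  refine lt_of_le_of_lt (measure_mono ?_) h
  intro x hx
  simpa using hx

lemma half_mass_le (hw : IsMongeAmperePotential τ V d w x₀) (hV : 0 < V) {s : ℝ}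
    (hs : 2 ^ n * Real.exp (-s / 2) ≤ 1 / 2) :
    V / 2 ≤ Real.exp (-w x₀) * volume.real {x | w x ≤ w x₀ + s} := by
  have hmeas : MeasurableSet {x | w x ≤ w x₀ + s} :=
    (isClosed_le hw.contDiff.continuous continuous_const).measurableSet
  have h1 := integral_add_compl hmeas hw.integrable
  have h2 : {x | w x ≤ w x₀ + s}ᶜ = {x | w x₀ + s < w x} := by
    ext x; simp
  have h3 := setIntegral_exp_neg_superlevel_le hw.contDiff.continuous hw.convexOn x₀
    hw.integrable s
  rw [h2] at h1
  rw [hw.integral_eq] at h1 h3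
  have h4 : ∫ x in {x | w x ≤ w x₀ + s}, Real.exp (-w x) ≤
      ∫ x in {x | w x ≤ w x₀ + s}, Real.exp (-w x₀) := by
    refine setIntegral_mono_on hw.integrable.integrableOn
      (integrableOn_const (hw.volume_sublevel_lt_top _).ne) hmeas fun x _ => ?_
    gcongr
    exact hw.isMin x
  rw [setIntegral_const, smul_eq_mul, mul_comm] at h4
  have h5 := mul_le_mul_of_nonneg_right hs hV.le
  linarith

lemma isCompact_sublevel (hw : IsMongeAmperePotential τ V d w x₀) (hd : 0 < d) {s : ℝ}
    (hs : 1 ≤ s) : IsCompact {x | w x ≤ w x₀ + s} := by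
  obtain ⟨R, hR⟩ := exists_subset_closedBall_of_volume_le (n := n) (inv_pos.2 hd)
    (hw.volume_sublevel_lt_top (w x₀ + s)).ne
  exact (isCompact_closedBall x₀ R).of_isClosed_subset
    (isClosed_le hw.contDiff.continuous continuous_const)
    (hR _ x₀ (hw.convex_sublevel _) (hw.ball_subset_sublevel hd hs) le_rfl)

open scoped Pointwise in
/-- An Alexandrov-type estimate for the volume of the sublevel sets. -/
lemma volume_sublevel_sq_le (hw : IsMongeAmperePotential τ V d w x₀) (hd : 0 < d) (hτ : 0 < τ)
    {s : ℝ} (hs : 1 ≤ s) :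
    τ * Real.exp (-(w x₀ + s)) * (1 / 2) ^ n * volume.real {x | w x ≤ w x₀ + s} ^ 2 ≤
      (2 * s) ^ n * volume.real (coordinateCube n) ^ 2 := by
  set A := {x | w x ≤ w x₀ + s} with hA
  have hs0 : 0 < s := by linarith
  have hball := hw.ball_subset_sublevel hd hs
  have hcompact := hw.isCompact_sublevel hd hs
  have hconv := hw.convex_sublevel (w x₀ + s)
  obtain ⟨c, hcA, hc⟩ := exists_volume_mul_volume_polar_le hcompact hconv
    ⟨x₀, interior_maximal hball Metric.isOpen_ball (Metric.mem_ball_self (inv_pos.2 hd))⟩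
  set P := {y | ∀ z ∈ A, ⟪y, z - c⟫ ≤ 1}
  set H := AffineMap.homothety c (1 / 2 : ℝ) '' A with hH
  have hHcompact : IsCompact H := hcompact.image (AffineMap.homothety_continuous c _)
  have hHA : H ⊆ A := by
    rintro _ ⟨z, hz, rfl⟩
    rw [AffineMap.homothety_apply, vsub_eq_sub, vadd_eq_add]
    have := hconv hz hcA (a := 1 / 2) (b := 1 / 2) (by norm_num) (by norm_num) (by norm_num)
    convert this using 1
    module
  have himage : gradient w '' H ⊆ (2 * s) • P := by
    rintro _ ⟨_, ⟨z, hz, rfl⟩, rfl⟩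
    rw [mem_smul_set_iff_inv_smul_mem₀ (by positivity)]
    intro z' hz'
    rw [AffineMap.homothety_apply, vsub_eq_sub, vadd_eq_add]
    set x := (1 / 2 : ℝ) • (z - c) + c
    have h1 := hw.tangent_le x (x + (1 / 2 : ℝ) • (z' - c))
    have h2 : x + (1 / 2 : ℝ) • (z' - c) ∈ A := by
      have := hconv hz hz' (a := 1 / 2) (b := 1 / 2) (by norm_num) (by norm_num) (by norm_num)
      convert this using 1
      module
    have h3 := hw.isMin x
    rw [add_sub_cancel_left, inner_smul_right] at h1
    rw [real_inner_smul_left, inv_mul_le_iff₀ (by positivity)]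
    simp only [hA, mem_ofPred_eq] at h2
    linarith
  have hlow : ENNReal.ofReal (τ * Real.exp (-(w x₀ + s))) * volume H ≤
      volume (gradient w '' H) := by
    rw [← lintegral_abs_det_fderiv_eq_addHaar_image volume hHcompact.measurableSet
      (fun x _ => (hw.contDiff.hasFDerivAt_gradient x).hasFDerivWithinAt)
      (gradient_injective hw.contDiff hw.hessian_pos).injOn, ← setLIntegral_const]
    refine setLIntegral_mono' hHcompact.measurableSet fun x hx => ?_
    apply ENNReal.ofReal_le_ofReal
    refine le_trans ?_ ((hw.le_det x).trans (le_abs_self _))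
    gcongr
    exact hHA hx
  have hup : volume (gradient w '' H) ≤ ENNReal.ofReal ((2 * s) ^ n) * volume P := by
    refine (measure_mono himage).trans_eq ?_
    rw [Measure.addHaar_smul, finrank_euclideanSpace_fin, abs_of_nonneg (by positivity)]
  rw [hH, Measure.addHaar_image_homothety, finrank_euclideanSpace_fin,
    abs_of_nonneg (by positivity), ← mul_assoc, ← ENNReal.ofReal_mul (by positivity)] at hlow
  have hfinal : ENNReal.ofReal (τ * Real.exp (-(w x₀ + s)) * (1 / 2) ^ n) * volume A ^ 2 ≤
      ENNReal.ofReal ((2 * s) ^ n) * volume (coordinateCube n) ^ 2 := by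
    calc _ = (ENNReal.ofReal (τ * Real.exp (-(w x₀ + s)) * (1 / 2) ^ n) * volume A) *
          volume A := by ring
      _ ≤ (ENNReal.ofReal ((2 * s) ^ n) * volume P) * volume A :=
        mul_le_mul_left (hlow.trans hup) _
      _ = ENNReal.ofReal ((2 * s) ^ n) * (volume A * volume P) := by ring
      _ ≤ _ := mul_le_mul_right hc _
  have := ENNReal.toReal_mono (ENNReal.mul_ne_top ENNReal.ofReal_ne_top
    (ENNReal.pow_ne_top volume_coordinateCube_lt_top.ne)) hfinal
  rwa [ENNReal.toReal_mul, ENNReal.toReal_mul, ENNReal.toReal_ofReal (by positivity),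
    ENNReal.toReal_ofReal (by positivity), ENNReal.toReal_pow, ENNReal.toReal_pow] at this

lemma volume_sublevel_le (hw : IsMongeAmperePotential τ V d w x₀) (hd : 0 < d) (hτ : 0 < τ)
    (hV : 0 < V) {s : ℝ} (hs : 1 ≤ s) (hs' : 2 ^ n * Real.exp (-s / 2) ≤ 1 / 2) :
    volume {x | w x ≤ w x₀ + s} ≤ ENNReal.ofReal ((2 * s) ^ n * volume.real (coordinateCube n) ^ 2 /
      (τ * Real.exp (-s) * (1 / 2) ^ n * (V / 2))) := by
  have h1 := hw.volume_sublevel_sq_le hd hτ hs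
  have h2 := hw.half_mass_le hV hs'
  rw [← ENNReal.ofReal_toReal (hw.volume_sublevel_lt_top (w x₀ + s)).ne]
  change ENNReal.ofReal (volume.real _) ≤ _
  set a := volume.real {x | w x ≤ w x₀ + s}
  have ha : 0 ≤ a := measureReal_nonneg
  apply ENNReal.ofReal_le_ofReal
  rw [le_div_iff₀ (by positivity)]
  refine le_trans ?_ h1
  rw [neg_add, Real.exp_add]
  have h3 := mul_le_mul_of_nonneg_left h2
    (show 0 ≤ τ * Real.exp (-s) * (1 / 2) ^ n * a by positivity)
  linarith

end IsMongeAmperePotential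

/-- The probability measures with density proportional to `exp (-w)`, for `w` a Monge–Ampère
potential with minimum at `x₀`, are tight after translating `x₀` to the origin. -/
lemma exists_setIntegral_compl_closedBall_le (n : ℕ) {τ V d ε : ℝ} (hd : 0 < d) (hτ : 0 < τ)
    (hV : 0 < V) (hε : 0 < ε) :
    ∃ R : ℝ, ∀ (w : EuclideanSpace ℝ (Fin n) → ℝ) (x₀ : EuclideanSpace ℝ (Fin n)),
      IsMongeAmperePotential τ V d w x₀ →
        ∫ x in (Metric.closedBall x₀ R)ᶜ, Real.exp (-w x) ≤ ε := by
  have hlim : Tendsto (fun s : ℝ => 2 ^ n * Real.exp (-s / 2)) atTop (𝓝 0) := by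
    have h1 : Tendsto (fun s : ℝ => -s / 2) atTop atBot := by
      have := (tendsto_neg_atTop_atBot (G := ℝ)).atBot_div_const (r := 2) (by norm_num)
      exact this
    simpa using (Real.tendsto_exp_atBot.comp h1).const_mul (2 ^ n : ℝ)
  obtain ⟨s, hs1, hs2, hs3⟩ := ((eventually_ge_atTop (1 : ℝ)).and
    ((hlim.eventually_le_const (show (0 : ℝ) < 1 / 2 by norm_num)).and
      (hlim.eventually_le_const (show 0 < ε / V by positivity)))).exists
  obtain ⟨R, hR⟩ := exists_subset_closedBall_of_volume_le (n := n) (inv_pos.2 hd)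
    (C := ENNReal.ofReal ((2 * s) ^ n * volume.real (coordinateCube n) ^ 2 /
      (τ * Real.exp (-s) * (1 / 2) ^ n * (V / 2)))) ENNReal.ofReal_ne_top
  refine ⟨R, fun w x₀ hw => ?_⟩
  have hsub := hR _ x₀ (hw.convex_sublevel _) (hw.ball_subset_sublevel hd hs1)
    (hw.volume_sublevel_le hd hτ hV hs1 hs2)
  calc ∫ x in (Metric.closedBall x₀ R)ᶜ, Real.exp (-w x)
      ≤ ∫ x in {x | w x₀ + s < w x}, Real.exp (-w x) := by
        refine setIntegral_mono_set hw.integrable.integrableOn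
          (ae_of_all _ fun x => (Real.exp_pos _).le) (LE.le.eventuallyLE ?_)
        intro x hx
        by_contra h
        refine hx (hsub ?_)
        simpa using h
    _ ≤ _ := setIntegral_exp_neg_superlevel_le hw.contDiff.continuous hw.convexOn x₀
        hw.integrable s
    _ ≤ ε := by
      rw [hw.integral_eq]
      exact (le_div_iff₀ hV).1 hs3

end Tightness

section LogSumExp

variable {ι E : Type*} [Fintype ι] [Nonempty ι] [NormedAddCommGroup E] [InnerProductSpace ℝ E]
  (p : ι → E)

lemma sum_exp_inner_pos (x : E) : 0 < ∑ α, Real.exp ⟪p α, x⟫ :=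
  Finset.sum_pos (fun _ _ => Real.exp_pos _) Finset.univ_nonempty

lemma contDiff_log_sum_exp_inner (c : ℝ) :
    ContDiff ℝ 2 fun x => Real.log (∑ α, Real.exp ⟪p α, x⟫) + c := by
  refine ContDiff.add (ContDiff.log ?_ fun x => (sum_exp_inner_pos p x).ne') contDiff_const
  exact ContDiff.sum fun α _ => (innerSL ℝ (p α)).contDiff.exp

lemma gradient_log_sum_exp_inner [CompleteSpace E] (c : ℝ) (x : E) :
    gradient (fun x => Real.log (∑ α, Real.exp ⟪p α, x⟫) + c) x =
      (∑ α, Real.exp ⟪p α, x⟫)⁻¹ • ∑ α, Real.exp ⟪p α, x⟫ • p α := by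
  apply HasGradientAt.gradient
  rw [hasGradientAt_iff_hasFDerivAt]
  have h1 : HasFDerivAt (fun x => ∑ α, Real.exp ⟪p α, x⟫)
      (∑ α, Real.exp ⟪p α, x⟫ • innerSL ℝ (p α)) x :=
    HasFDerivAt.fun_sum fun α _ => (innerSL ℝ (p α)).hasFDerivAt.exp
  refine ((h1.log (sum_exp_inner_pos p x).ne').add_const c).congr_fderiv ?_
  ext y
  simp

lemma inner_gradient_log_sum_exp_inner [CompleteSpace E] (c : ℝ) (v x : E) :
    ⟪v, gradient (fun x => Real.log (∑ α, Real.exp ⟪p α, x⟫) + c) x⟫ =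
      (∑ α, Real.exp ⟪p α, x⟫ * ⟪v, p α⟫) / ∑ α, Real.exp ⟪p α, x⟫ := by
  rw [gradient_log_sum_exp_inner, inner_smul_right, inner_sum, div_eq_inv_mul]
  simp [inner_smul_right]

/-- The function `log ∑ exp ⟪p α, x⟫` lies above its tangent hyperplanes. -/
lemma log_sum_exp_inner_tangent_le [CompleteSpace E] (c : ℝ) (x y : E) :
    (Real.log (∑ α, Real.exp ⟪p α, x⟫) + c) +
        ⟪gradient (fun x => Real.log (∑ α, Real.exp ⟪p α, x⟫) + c) x, y - x⟫ ≤
      Real.log (∑ α, Real.exp ⟪p α, y⟫) + c := by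
  set Z := ∑ α, Real.exp ⟪p α, x⟫ with hZ
  have hZ0 : 0 < Z := sum_exp_inner_pos p x
  have hJ := convexOn_exp.map_sum_le (t := Finset.univ)
    (w := fun α => Real.exp ⟪p α, x⟫ / Z) (p := fun α => ⟪p α, y - x⟫)
    (fun α _ => by positivity) (by rw [← Finset.sum_div, div_self hZ0.ne']) (fun _ _ => mem_univ _)
  have h1 : ∑ α, (Real.exp ⟪p α, x⟫ / Z) • Real.exp ⟪p α, y - x⟫ =
      (∑ α, Real.exp ⟪p α, y⟫) / Z := by
    rw [Finset.sum_div]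
    refine Finset.sum_congr rfl fun α _ => ?_
    rw [smul_eq_mul, div_mul_eq_mul_div, ← Real.exp_add, inner_sub_right, add_sub_cancel]
  have h2 : ∑ α, (Real.exp ⟪p α, x⟫ / Z) • ⟪p α, y - x⟫ =
      ⟪gradient (fun x => Real.log (∑ α, Real.exp ⟪p α, x⟫) + c) x, y - x⟫ := by
    rw [real_inner_comm, inner_gradient_log_sum_exp_inner, Finset.sum_div]
    refine Finset.sum_congr rfl fun α _ => ?_
    rw [smul_eq_mul, real_inner_comm (p α), div_mul_eq_mul_div]
  rw [h1, h2] at hJ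
  have h3 := Real.log_le_log (Real.exp_pos _) hJ
  rw [Real.log_exp, Real.log_div (sum_exp_inner_pos p y).ne' hZ0.ne'] at h3
  linarith

lemma inner_le_log_sum_exp_inner (α : ι) (x : E) :
    ⟪p α, x⟫ ≤ Real.log (∑ α, Real.exp ⟪p α, x⟫) := by
  rw [Real.le_log_iff_exp_le (sum_exp_inner_pos p x)]
  exact Finset.single_le_sum (f := fun α => Real.exp ⟪p α, x⟫) (fun _ _ => (Real.exp_pos _).le)
    (Finset.mem_univ α)

/-- A Harnack inequality for the affine functions defining the faces, evaluated along the gradient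
of `log ∑ exp ⟪p α, x⟫`. -/
lemma one_add_inner_gradient_log_sum_exp_le [CompleteSpace E] (c : ℝ) {v : E} {d : ℝ}
    (hp : ∀ α, ‖p α‖ ≤ d) (hv : ∀ α, -1 ≤ ⟪v, p α⟫) (x y : E) :
    1 + ⟪v, gradient (fun x => Real.log (∑ α, Real.exp ⟪p α, x⟫) + c) x⟫ ≤
      Real.exp (2 * d * ‖x - y‖) *
        (1 + ⟪v, gradient (fun x => Real.log (∑ α, Real.exp ⟪p α, x⟫) + c) y⟫) := by
  have key : ∀ x, 1 + ⟪v, gradient (fun x => Real.log (∑ α, Real.exp ⟪p α, x⟫) + c) x⟫ =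
      (∑ α, Real.exp ⟪p α, x⟫ * (1 + ⟪v, p α⟫)) / ∑ α, Real.exp ⟪p α, x⟫ := by
    intro x
    rw [inner_gradient_log_sum_exp_inner, one_add_div (sum_exp_inner_pos p x).ne',
      ← Finset.sum_add_distrib]
    simp only [mul_add, mul_one]
  have hexp : ∀ (x y : E) (α : ι),
      Real.exp ⟪p α, x⟫ ≤ Real.exp (d * ‖x - y‖) * Real.exp ⟪p α, y⟫ := by
    intro x y α
    rw [← Real.exp_add]
    gcongr
    have h1 : ⟪p α, x - y⟫ ≤ d * ‖x - y‖ :=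
      (real_inner_le_norm _ _).trans (by gcongr; exact hp α)
    rw [inner_sub_right] at h1
    linarith
  rw [key, key, div_le_iff₀ (sum_exp_inner_pos p x), mul_assoc, div_mul_eq_mul_div,
    mul_div_assoc', le_div_iff₀ (sum_exp_inner_pos p y)]
  have h1 : ∑ α, Real.exp ⟪p α, x⟫ * (1 + ⟪v, p α⟫) ≤
      Real.exp (d * ‖x - y‖) * ∑ α, Real.exp ⟪p α, y⟫ * (1 + ⟪v, p α⟫) := by
    rw [Finset.mul_sum]
    refine Finset.sum_le_sum fun α _ => ?_
    rw [← mul_assoc]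
    exact mul_le_mul_of_nonneg_right (hexp x y α) (by linarith [hv α])
  have h2 : ∑ α, Real.exp ⟪p α, y⟫ ≤ Real.exp (d * ‖x - y‖) * ∑ α, Real.exp ⟪p α, x⟫ := by
    rw [Finset.mul_sum]
    refine Finset.sum_le_sum fun α _ => ?_
    rw [norm_sub_rev]
    exact hexp y x α
  have h0 : 0 ≤ ∑ α, Real.exp ⟪p α, y⟫ * (1 + ⟪v, p α⟫) :=
    Finset.sum_nonneg fun α _ => mul_nonneg (Real.exp_pos _).le (by linarith [hv α])
  calc _ ≤ (Real.exp (d * ‖x - y‖) * ∑ α, Real.exp ⟪p α, y⟫ * (1 + ⟪v, p α⟫)) *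
        (Real.exp (d * ‖x - y‖) * ∑ α, Real.exp ⟪p α, x⟫) :=
        mul_le_mul h1 h2 (sum_exp_inner_pos p y).le (by positivity)
    _ = _ := by
      rw [show 2 * d * ‖x - y‖ = d * ‖x - y‖ + d * ‖x - y‖ by ring, Real.exp_add]
      ring

/-- The gradient of `log ∑ exp ⟪p α, x⟫` leaves every compact subset of the interior of the convex
hull of the points `p α` as `x` tends to infinity. -/
lemma notMem_interior_of_tendsto_gradient_log_sum_exp [CompleteSpace E] (c : ℝ) {x : ℕ → E}
    (hx : Tendsto (fun i => ‖x i‖) atTop atTop) {z : E}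
    (hz : Tendsto (fun i => gradient (fun x => Real.log (∑ α, Real.exp ⟪p α, x⟫) + c) (x i))
      atTop (𝓝 z)) : z ∉ interior (convexHull ℝ (range p)) := by
  intro hzint
  obtain ⟨r, hr, hball⟩ := Metric.isOpen_iff.1 isOpen_interior z hzint
  obtain ⟨i, h1, h2⟩ := ((hz.eventually (Metric.ball_mem_nhds z (half_pos hr))).and
    (hx.eventually_gt_atTop (max 0 (Real.log (∑ α, Real.exp ⟪p α, (0 : E)⟫) / (r / 2))))).exists
  set y := gradient (fun x => Real.log (∑ α, Real.exp ⟪p α, x⟫) + c) (x i) with hy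
  have hxpos : 0 < ‖x i‖ := (le_max_left _ _).trans_lt h2
  have hlarge := (le_max_right _ _).trans_lt h2
  rw [div_lt_iff₀ (half_pos hr)] at hlarge
  set y' := y + (r / 2 / ‖x i‖) • x i with hy'
  have hy'mem : y' ∈ convexHull ℝ (range p) := by
    apply interior_subset (hball _)
    rw [Metric.mem_ball]
    have h3 : dist y' y ≤ r / 2 := by
      rw [dist_eq_norm, hy', add_sub_cancel_left, norm_smul, norm_div, norm_norm,
        Real.norm_of_nonneg (half_pos hr).le, div_mul_cancel₀ _ hxpos.ne']
    linarith [dist_triangle y' y z, Metric.mem_ball.1 h1]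
  have hle : ⟪y', x i⟫ ≤ Real.log (∑ α, Real.exp ⟪p α, x i⟫) := by
    have hc : Convex ℝ {y : E | ⟪y, x i⟫ ≤ Real.log (∑ α, Real.exp ⟪p α, x i⟫)} :=
      convex_halfSpace_le ⟨fun a b => inner_add_left a b _,
        fun a b => by simp [inner_smul_left]⟩ _
    refine convexHull_min ?_ hc hy'mem
    rintro _ ⟨α, rfl⟩
    exact inner_le_log_sum_exp_inner p α (x i)
  have htan := log_sum_exp_inner_tangent_le p c (x i) 0
  rw [← hy, zero_sub, inner_neg_right] at htan
  rw [hy', inner_add_left, real_inner_smul_left, real_inner_self_eq_norm_sq] at hle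
  have h4 : r / 2 / ‖x i‖ * ‖x i‖ ^ 2 = ‖x i‖ * (r / 2) := by field_simp
  rw [h4] at hle
  linarith

end LogSumExp

section Integration

variable {n : ℕ}

/-- The integral of the gradient of `exp (-w)` vanishes. -/
lemma integral_exp_neg_smul_gradient_eq_zero {w : EuclideanSpace ℝ (Fin n) → ℝ}
    (hw : ContDiff ℝ 2 w) (hint : Integrable fun x => Real.exp (-w x)) {d : ℝ}
    (hd : ∀ x, ‖gradient w x‖ ≤ d) :
    ∫ x, Real.exp (-w x) • gradient w x = 0 := by
  have hgi : Integrable fun x => Real.exp (-w x) • gradient w x := by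
    refine hint.smul_bdd d hw.contDiff_gradient.continuous.aestronglyMeasurable (ae_of_all _ hd)
  refine ext_inner_left ℝ fun h => ?_
  rw [inner_zero_right, ← integral_inner hgi]
  have hder : ∀ x, HasFDerivAt (fun x => Real.exp (-w x))
      (Real.exp (-w x) • -fderiv ℝ w x) x := fun x =>
    (hw.differentiable (by norm_num) x).hasFDerivAt.neg.exp
  have hfd : ∀ x, fderiv ℝ (fun x => Real.exp (-w x)) x h =
      -⟪h, Real.exp (-w x) • gradient w x⟫ := by
    intro x
    rw [(hder x).fderiv, inner_smul_right, real_inner_comm, inner_gradient_left]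
    simp
  have h1 := integral_smul_fderiv_eq_neg_fderiv_smul_of_integrable (𝕜 := ℝ) (μ := volume)
    (f := fun _ : EuclideanSpace ℝ (Fin n) => (1 : ℝ)) (g := fun x => Real.exp (-w x)) (v := h)
    (by simp) (by simpa [hfd] using (hgi.const_inner h).neg) (by simpa using hint)
    (fun x _ => differentiableAt_const _) (fun x _ => (hder x).differentiableAt)
  simpa [hfd, integral_neg] using h1

/-- The gradient of `g` transports the measure with density `det D²g` to Lebesgue measure on the
image. -/
lemma gradient_transport {g f : EuclideanSpace ℝ (Fin n) → ℝ} (hg : ContDiff ℝ 2 g)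
    (hinj : Function.Injective (gradient g)) (hf : ∀ x, 0 ≤ f x)
    (hdet : ∀ x, LinearMap.det (fderiv ℝ (gradient g) x).toLinearMap = f x)
    {Δ : Set (EuclideanSpace ℝ (Fin n))} (hΔ : IsCompact Δ) (hconv : Convex ℝ Δ)
    (hrange : range (gradient g) = interior Δ) :
    Integrable f ∧ ∫ x, f x = volume.real Δ ∧ ∫ x, f x • gradient g x = ∫ y in Δ, y := by
  have hae : (interior Δ : Set _) =ᵐ[volume] Δ :=
    interior_ae_eq_of_null_frontier (hconv.addHaar_frontier volume)
  have habs : ∀ x, |(fderiv ℝ (gradient g) x).det| = f x := fun x => by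
    rw [ContinuousLinearMap.det, hdet, abs_of_nonneg (hf x)]
  have hd : ∀ x ∈ (univ : Set (EuclideanSpace ℝ (Fin n))), HasFDerivWithinAt (gradient g)
      (fderiv ℝ (gradient g) x) univ x :=
    fun x _ => (hg.hasFDerivAt_gradient x).hasFDerivWithinAt
  have hchange : ∀ F : Type, [inst1 : NormedAddCommGroup F] → [inst2 : NormedSpace ℝ F] →
      ∀ φ : EuclideanSpace ℝ (Fin n) → F,
        ∫ y in Δ, φ y = ∫ x, f x • φ (gradient g x) := by
    intro F _ _ φ
    rw [← setIntegral_congr_set hae, ← hrange, ← image_univ,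
      integral_image_eq_integral_abs_det_fderiv_smul volume MeasurableSet.univ hd hinj.injOn]
    simp [habs]
  have hi : IntegrableOn (fun _ : EuclideanSpace ℝ (Fin n) => (1 : ℝ)) (gradient g '' univ) := by
    rw [image_univ, hrange]
    exact integrableOn_const ((measure_mono interior_subset).trans_lt hΔ.measure_lt_top).ne
  rw [integrableOn_image_iff_integrableOn_abs_det_fderiv_smul volume MeasurableSet.univ hd
    hinj.injOn] at hi
  refine ⟨by simpa [habs] using hi, ?_, ?_⟩
  · have := hchange ℝ fun _ => 1
    simpa using this.symm
  · exact (hchange _ fun y => y).symm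

/-- If the measures with densities `F i` are tight around the points `x i` and `ℓ` satisfies a
Harnack inequality, then `∫ ℓ F i` tends to zero if and only if `ℓ (x i)` does. -/
lemma limit_integral_eq_zero_iff {E : Type*} [NormedAddCommGroup E] [MeasurableSpace E]
    [BorelSpace E] {μ : Measure E} {F : ℕ → E → ℝ} {x : ℕ → E} {V : ℝ} (hV : 0 < V)
    (hF : ∀ i y, 0 ≤ F i y) (hFi : ∀ i, Integrable (F i) μ) (hFV : ∀ i, ∫ y, F i y ∂μ = V)
    (htight : ∀ ε > 0, ∃ R : ℝ, ∀ᶠ i in atTop,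
      ∫ y in (Metric.closedBall (x i) R)ᶜ, F i y ∂μ ≤ ε)
    {ℓ : E → ℝ} {B D : ℝ} (hℓ0 : ∀ y, 0 ≤ ℓ y) (hℓB : ∀ y, ℓ y ≤ B) (hD : 0 ≤ D)
    (hharnack : ∀ y z, ℓ y ≤ Real.exp (D * ‖y - z‖) * ℓ z)
    (hℓi : ∀ i, Integrable (fun y => F i y * ℓ y) μ)
    {a L : ℝ} (ha : Tendsto (fun i => ℓ (x i)) atTop (𝓝 a))
    (hL : Tendsto (fun i => ∫ y, F i y * ℓ y ∂μ) atTop (𝓝 L)) : L = 0 ↔ a = 0 := by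
  have hB : 0 ≤ B := (hℓ0 (x 0)).trans (hℓB _)
  have ha0 : 0 ≤ a := ge_of_tendsto' ha fun i => hℓ0 _
  have hL0 : 0 ≤ L := ge_of_tendsto' hL fun i =>
    integral_nonneg fun y => mul_nonneg (hF i y) (hℓ0 y)
  have hball : ∀ i R, MeasurableSet (Metric.closedBall (x i) R) := fun i R =>
    Metric.isClosed_closedBall.measurableSet
  constructor
  · rintro rfl
    obtain ⟨R, hR⟩ := htight (V / 2) (half_pos hV)
    have hbound : ∀ᶠ i in atTop, Real.exp (-(D * R)) * (V / 2) * ℓ (x i) ≤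
        ∫ y, F i y * ℓ y ∂μ := by
      filter_upwards [hR] with i hi
      have h1 := integral_add_compl (hball i R) (hFi i)
      rw [hFV] at h1
      have h2 : ∫ y in Metric.closedBall (x i) R, F i y * (Real.exp (-(D * R)) * ℓ (x i)) ∂μ ≤
          ∫ y in Metric.closedBall (x i) R, F i y * ℓ y ∂μ := by
        refine setIntegral_mono_on ((hFi i).mul_const _).integrableOn (hℓi i).integrableOn
          (hball i R) fun y hy => mul_le_mul_of_nonneg_left ?_ (hF i y)
        rw [Real.exp_neg, inv_mul_le_iff₀ (Real.exp_pos _)]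
        refine (hharnack (x i) y).trans (mul_le_mul_of_nonneg_right ?_ (hℓ0 y))
        rw [Metric.mem_closedBall, dist_comm, dist_eq_norm] at hy
        gcongr
      have h3 : ∫ y in Metric.closedBall (x i) R, F i y * ℓ y ∂μ ≤ ∫ y, F i y * ℓ y ∂μ :=
        setIntegral_le_integral (hℓi i) (ae_of_all _ fun y => mul_nonneg (hF i y) (hℓ0 y))
      rw [integral_mul_const] at h2
      have h4 : 0 ≤ Real.exp (-(D * R)) * ℓ (x i) := mul_nonneg (Real.exp_pos _).le (hℓ0 _)
      have h5 := mul_le_mul_of_nonneg_right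
        (show V / 2 ≤ ∫ y in Metric.closedBall (x i) R, F i y ∂μ by linarith) h4
      linarith
    have h6 := le_of_tendsto_of_tendsto (ha.const_mul (Real.exp (-(D * R)) * (V / 2))) hL hbound
    have h7 : 0 < Real.exp (-(D * R)) * (V / 2) := by positivity
    by_contra hne
    have := mul_pos h7 (lt_of_le_of_ne ha0 (Ne.symm hne))
    linarith
  · rintro rfl
    refine le_antisymm (le_of_forall_pos_le_add fun ε hε => ?_) hL0
    obtain ⟨R, hR⟩ := htight (ε / (B + 1)) (by positivity)
    have hbound : ∀ᶠ i in atTop, ∫ y, F i y * ℓ y ∂μ ≤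
        V * (Real.exp (D * R) * ℓ (x i)) + ε := by
      filter_upwards [hR] with i hi
      rw [← integral_add_compl (hball i R) (hℓi i)]
      have h2 : ∫ y in Metric.closedBall (x i) R, F i y * ℓ y ∂μ ≤
          ∫ y in Metric.closedBall (x i) R, F i y * (Real.exp (D * R) * ℓ (x i)) ∂μ := by
        refine setIntegral_mono_on (hℓi i).integrableOn ((hFi i).mul_const _).integrableOn
          (hball i R) fun y hy => mul_le_mul_of_nonneg_left ?_ (hF i y)
        refine (hharnack y (x i)).trans (mul_le_mul_of_nonneg_right ?_ (hℓ0 _))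
        rw [Metric.mem_closedBall, dist_eq_norm] at hy
        gcongr
      have h3 : ∫ y in (Metric.closedBall (x i) R)ᶜ, F i y * ℓ y ∂μ ≤
          ∫ y in (Metric.closedBall (x i) R)ᶜ, F i y * (B + 1) ∂μ := by
        refine setIntegral_mono_on (hℓi i).integrableOn ((hFi i).mul_const _).integrableOn
          (hball i R).compl fun y hy => mul_le_mul_of_nonneg_left ?_ (hF i y)
        linarith [hℓB y]
      have h4 : ∫ y in Metric.closedBall (x i) R, F i y ∂μ ≤ V := by
        rw [← hFV i]
        exact setIntegral_le_integral (hFi i) (ae_of_all _ (hF i))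
      rw [integral_mul_const] at h2 h3
      have h5 : 0 ≤ Real.exp (D * R) * ℓ (x i) := mul_nonneg (Real.exp_pos _).le (hℓ0 _)
      have h6 := mul_le_mul_of_nonneg_right h4 h5
      have h7 := (le_div_iff₀ (by positivity)).1 hi
      linarith
    have h8 := le_of_tendsto_of_tendsto hL
      (((ha.const_mul (Real.exp (D * R))).const_mul V).add_const ε) hbound
    simpa using h8

end Integration

section Interpolation

variable {n : ℕ} {f g : EuclideanSpace ℝ (Fin n) → ℝ} {s : ℝ}

lemma gradient_interpolation (hf : ContDiff ℝ 2 f) (hg : ContDiff ℝ 2 g) :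
    gradient (fun y => (1 - s) * f y + s * g y) =
      fun y => (1 - s) • gradient f y + s • gradient g y := by
  funext y
  apply HasGradientAt.gradient
  rw [hasGradientAt_iff_hasFDerivAt]
  refine (((hf.differentiable (by norm_num) y).hasFDerivAt.const_mul (1 - s)).add
    ((hg.differentiable (by norm_num) y).hasFDerivAt.const_mul s)).congr_fderiv ?_
  simp

lemma fderiv_gradient_interpolation (hf : ContDiff ℝ 2 f) (hg : ContDiff ℝ 2 g)
    (y : EuclideanSpace ℝ (Fin n)) :
    fderiv ℝ (gradient fun y => (1 - s) * f y + s * g y) y =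
      (1 - s) • fderiv ℝ (gradient f) y + s • fderiv ℝ (gradient g) y := by
  rw [gradient_interpolation hf hg]
  exact (((hf.hasFDerivAt_gradient y).const_smul (1 - s)).add
    ((hg.hasFDerivAt_gradient y).const_smul s)).fderiv

/-- Solutions of the continuity path `det D²g = exp (-w)`, `w = (1 - s) f + s g`, give
potentials `w` for which the tightness estimate applies. -/
lemma isMongeAmperePotential_interpolation (hf : ContDiff ℝ 2 f) (hg : ContDiff ℝ 2 g)
    (hfpos : ∀ x h, 0 ≤ ⟪fderiv ℝ (gradient f) x h, h⟫)
    (hgpos : ∀ x h, h ≠ 0 → 0 < ⟪fderiv ℝ (gradient g) x h, h⟫)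
    (hs : s ∈ Ioo (0 : ℝ) 1) {τ : ℝ} (hτ : τ ≤ s ^ n)
    (hdet : ∀ x, LinearMap.det (fderiv ℝ (gradient g) x).toLinearMap =
      Real.exp (-((1 - s) * f x + s * g x)))
    {x₀ : EuclideanSpace ℝ (Fin n)}
    (hmin : ∀ y, (1 - s) * f x₀ + s * g x₀ ≤ (1 - s) * f y + s * g y) {d V : ℝ}
    (hfd : ∀ x, ‖gradient f x‖ ≤ d) (hgd : ∀ x, ‖gradient g x‖ ≤ d)
    (hint : Integrable fun x => Real.exp (-((1 - s) * f x + s * g x)))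
    (hV : ∫ x, Real.exp (-((1 - s) * f x + s * g x)) = V) :
    IsMongeAmperePotential τ V d (fun y => (1 - s) * f y + s * g y) x₀ := by
  have h1s : 0 < 1 - s := sub_pos.2 hs.2
  refine ⟨(contDiff_const.mul hf).add (contDiff_const.mul hg), fun x h hh => ?_, fun x => ?_,
    hmin, fun x => ?_, hint, hV⟩
  · rw [fderiv_gradient_interpolation hf hg]
    have h1 := mul_nonneg h1s.le (hfpos x h)
    have h2 := mul_pos hs.1 (hgpos x h hh)
    simp only [add_apply, smul_apply, inner_add_left,
      real_inner_smul_left]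
    linarith
  · rw [fderiv_gradient_interpolation hf hg]
    have hA : (s • (fderiv ℝ (gradient g) x).toLinearMap).IsPositive := by
      refine ⟨(hg.isSymmetric_fderiv_gradient x).smul (by simp), fun h => ?_⟩
      rcases eq_or_ne h 0 with rfl | hh
      · simp
      · simpa [real_inner_smul_left] using (mul_pos hs.1 (hgpos x h hh)).le
    have hB : ((1 - s) • (fderiv ℝ (gradient f) x).toLinearMap).IsPositive := by
      refine ⟨(hf.isSymmetric_fderiv_gradient x).smul (by simp), fun h => ?_⟩
      simpa [real_inner_smul_left] using mul_nonneg h1s.le (hfpos x h)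
    have h := hA.det_le_det_add hB
    rw [LinearMap.det_smul, finrank_euclideanSpace_fin, hdet,
      add_comm (s • (fderiv ℝ (gradient g) x).toLinearMap)] at h
    exact (mul_le_mul_of_nonneg_right hτ (Real.exp_pos _).le).trans h
  · rw [gradient_interpolation hf hg]
    calc ‖(1 - s) • gradient f x + s • gradient g x‖
        ≤ (1 - s) * ‖gradient f x‖ + s * ‖gradient g x‖ := by
          refine (norm_add_le _ _).trans_eq ?_
          rw [norm_smul, norm_smul, Real.norm_of_nonneg h1s.le, Real.norm_of_nonneg hs.1.le]
      _ ≤ (1 - s) * d + s * d := by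
          gcongr
          exacts [hfd x, hs.1.le, hgd x]
      _ = d := by ring

end Interpolation

section Polyhedron

variable {E κ : Type*} [NormedAddCommGroup E] [InnerProductSpace ℝ E] {v : κ → E}

/-- A boundary point of a polyhedron lies on one of its faces. -/
lemma exists_inner_eq_neg_one_of_notMem_interior [Finite κ] {y : E} (hy : ∀ r, -1 ≤ ⟪v r, y⟫)
    (hyi : y ∉ interior {y | ∀ r, -1 ≤ ⟪v r, y⟫}) : ∃ r, ⟪v r, y⟫ = -1 := by
  by_contra! hne
  apply hyi
  have hopen : IsOpen (⋂ r, {y | -1 < ⟪v r, y⟫}) :=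
    isOpen_iInter_of_finite fun r =>
      isOpen_lt continuous_const (continuous_const.inner continuous_id)
  refine interior_maximal (fun z hz r => ?_) hopen (mem_iInter.2 fun r =>
    lt_of_le_of_ne (hy r) (hne r).symm)
  exact (mem_iInter.1 hz r).le

lemma notMem_interior_of_inner_eq_neg_one {y : E} {r : κ} (hr : ⟪v r, y⟫ = -1) :
    y ∉ interior {y | ∀ r, -1 ≤ ⟪v r, y⟫} := by
  intro hy
  have hc : ContinuousAt (fun s : ℝ => y - s • v r) 0 := by fun_prop
  have h0 : (fun s : ℝ => y - s • v r) 0 ∈ interior {y | ∀ r, -1 ≤ ⟪v r, y⟫} := by simpa using hy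
  have h1 := hc.eventually (isOpen_interior.mem_nhds h0)
  obtain ⟨s, hs, hs0⟩ := ((h1.filter_mono nhdsWithin_le_nhds).and
    (self_mem_nhdsWithin : Ioi (0 : ℝ) ∈ 𝓝[>] 0)).exists
  have h2 : -1 ≤ ⟪v r, y - s • v r⟫ := interior_subset hs r
  rw [inner_sub_right, hr, real_inner_smul_right, real_inner_self_eq_norm_sq] at h2
  have hv : v r ≠ 0 := fun h => by simp [h] at hr
  have := mul_pos (mem_Ioi.1 hs0) (pow_pos (norm_pos_iff.2 hv) 2)
  linarith

end Polyhedron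

/-- blow-up analysis determining `R(X_Δ)`: Let `Δ = conv{p₁,…,p_N} ⊂ ℝⁿ`
contain the origin in its interior and be cut out by `⟪v_r, y⟫ ≥ -1`, `r = 1,…,K`.
Let `u₀(x) = log ∑_α e^{⟪p_α,x⟫} + c₀` be normalized by `∫ e^{-u₀} = vol Δ` with
`∇u₀(ℝⁿ) = int Δ`, and `P_c` the barycenter of `Δ`.  Suppose `t_i ∈ (0,1)`, `t_i → T ∈
(0,1)`, and `u_i` are smooth with positive-definite Hessians, `∇u_i(ℝⁿ) = int Δ`,
`det D²u_i = e^{-w_i}` with `w_i = (1-t_i)u₀ + t_i u_i`, minimized at `x_i`, with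
`‖x_i‖ → ∞` and `∇u₀(x_i) → y_∞`.  Then `y_∞ ∈ ∂Δ`, `⟪v_r, -(T/(1-T))P_c⟫ ≥ -1` for
all `r` with equality iff `⟪v_r, y_∞⟫ = -1`, and `-(T/(1-T))P_c ∈ ∂Δ`. -/
theorem toric_blowup_barycenter_on_boundary {n N K : ℕ}
    (p : Fin N → EuclideanSpace ℝ (Fin n))
    (Δ : Set (EuclideanSpace ℝ (Fin n)))
    (hΔdef : Δ = convexHull ℝ (Set.range p))
    (hΔ0 : (0 : EuclideanSpace ℝ (Fin n)) ∈ interior Δ)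
    (v : Fin K → EuclideanSpace ℝ (Fin n))
    (hΔfaces : Δ = {y | ∀ r : Fin K, -1 ≤ ⟪v r, y⟫})
    (c₀ : ℝ) (u₀ : EuclideanSpace ℝ (Fin n) → ℝ)
    (hu₀def : ∀ x, u₀ x = Real.log (∑ α, Real.exp ⟪p α, x⟫) + c₀)
    (hu₀norm : (∫ x, Real.exp (-(u₀ x))) = (volume Δ).toReal)
    (hu₀grad : Set.range (gradient u₀) = interior Δ)
    (Pc : EuclideanSpace ℝ (Fin n))
    (hPc : Pc = (volume Δ).toReal⁻¹ • ∫ y in Δ, y)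
    (T : ℝ) (hT : T ∈ Set.Ioo (0 : ℝ) 1)
    (t : ℕ → ℝ) (ht : ∀ i, t i ∈ Set.Ioo (0 : ℝ) 1)
    (htT : Filter.Tendsto t Filter.atTop (nhds T))
    (u : ℕ → EuclideanSpace ℝ (Fin n) → ℝ)
    (husmooth : ∀ i, ContDiff ℝ (⊤ : ℕ∞) (u i))
    (hupos : ∀ i x h, h ≠ 0 → 0 < ⟪(fderiv ℝ (gradient (u i)) x) h, h⟫)
    (hugrad : ∀ i, Set.range (gradient (u i)) = interior Δ)
    (hudet : ∀ i x, LinearMap.det (fderiv ℝ (gradient (u i)) x).toLinearMap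
        = Real.exp (-((1 - t i) * u₀ x + t i * u i x)))
    (x : ℕ → EuclideanSpace ℝ (Fin n))
    (hxmin : ∀ i y, (1 - t i) * u₀ (x i) + t i * u i (x i)
        ≤ (1 - t i) * u₀ y + t i * u i y)
    (hxinf : Filter.Tendsto (fun i => ‖x i‖) Filter.atTop Filter.atTop)
    (yinf : EuclideanSpace ℝ (Fin n))
    (hyinf : Filter.Tendsto (fun i => gradient u₀ (x i)) Filter.atTop (nhds yinf)) :
    yinf ∈ frontier Δ ∧
    (∀ r : Fin K, -1 ≤ ⟪v r, -(T / (1 - T)) • Pc⟫) ∧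
    (∀ r : Fin K, ⟪v r, -(T / (1 - T)) • Pc⟫ = -1 ↔ ⟪v r, yinf⟫ = -1) ∧
    -(T / (1 - T)) • Pc ∈ frontier Δ := by
  obtain rfl : u₀ = fun x => Real.log (∑ α, Real.exp ⟪p α, x⟫) + c₀ := funext hu₀def
  set u₀ : EuclideanSpace ℝ (Fin n) → ℝ := fun x => Real.log (∑ α, Real.exp ⟪p α, x⟫) + c₀
  have hΔ0' : (0 : EuclideanSpace ℝ (Fin n)) ∈ Δ := interior_subset hΔ0
  have : Nonempty (Fin N) := by
    rw [hΔdef] at hΔ0'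
    exact range_nonempty_iff_nonempty.1 (convexHull_nonempty_iff.1 ⟨0, hΔ0'⟩)
  have hΔc : IsCompact Δ := hΔdef ▸ (finite_range p).isCompact_convexHull ℝ
  have hΔconv : Convex ℝ Δ := hΔdef ▸ convex_convexHull ℝ _
  have hpΔ : ∀ α, p α ∈ Δ := fun α => hΔdef ▸ subset_convexHull ℝ _ (mem_range_self α)
  have hΔv : ∀ y ∈ Δ, ∀ r, -1 ≤ ⟪v r, y⟫ := fun y hy => by rwa [hΔfaces] at hy
  obtain ⟨d, hd0, hd⟩ := hΔc.isBounded.exists_pos_norm_le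
  have hVpos : 0 < volume.real Δ := by
    refine ENNReal.toReal_pos (ne_of_gt ?_) hΔc.measure_lt_top.ne
    exact (isOpen_interior.measure_pos volume ⟨0, hΔ0⟩).trans_le (measure_mono interior_subset)
  have hu₀C : ContDiff ℝ 2 u₀ := contDiff_log_sum_exp_inner p c₀
  have huC : ∀ i, ContDiff ℝ 2 (u i) := fun i => contDiff_infty.1 (husmooth i) 2
  have hu₀Δ : ∀ y, gradient u₀ y ∈ Δ := fun y => interior_subset (hu₀grad ▸ mem_range_self y)
  have huΔ : ∀ i y, gradient (u i) y ∈ Δ := fun i y =>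
    interior_subset (hugrad i ▸ mem_range_self y)
  have hu₀pos := inner_fderiv_gradient_nonneg hu₀C (log_sum_exp_inner_tangent_le p c₀)
  set w : ℕ → EuclideanSpace ℝ (Fin n) → ℝ := fun i y => (1 - t i) * u₀ y + t i * u i y with hw
  have htrans := fun i => gradient_transport (f := fun y => Real.exp (-w i y)) (huC i)
    (gradient_injective (huC i) (hupos i)) (fun y => (Real.exp_pos _).le) (hudet i) hΔc hΔconv
    (hugrad i)
  have hpot : ∀ i τ, τ ≤ t i ^ n → IsMongeAmperePotential τ (volume.real Δ) d (w i) (x i) :=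
    fun i τ hτ => isMongeAmperePotential_interpolation hu₀C (huC i) hu₀pos (hupos i) (ht i) hτ
      (hudet i) (hxmin i) (fun y => hd _ (hu₀Δ y)) (fun y => hd _ (huΔ i y)) (htrans i).1
      (htrans i).2.1
  have htight : ∀ ε > 0, ∃ R : ℝ, ∀ᶠ i in atTop,
      ∫ y in (Metric.closedBall (x i) R)ᶜ, Real.exp (-w i y) ≤ ε := by
    intro ε hε
    obtain ⟨R, hR⟩ := exists_setIntegral_compl_closedBall_le n hd0
      (pow_pos (half_pos hT.1) n) hVpos hε
    refine ⟨R, ?_⟩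
    filter_upwards [htT.eventually_const_le (half_lt_self hT.1)] with i hi
    exact hR _ _ (hpot i _ (pow_le_pow_left₀ (half_pos hT.1).le hi n))
  have h1T : 0 < 1 - T := sub_pos.2 hT.2
  have hgi : ∀ i, Integrable fun y => Real.exp (-w i y) • gradient u₀ y := fun i =>
    (htrans i).1.smul_bdd d hu₀C.contDiff_gradient.continuous.aestronglyMeasurable
      (ae_of_all _ fun y => hd _ (hu₀Δ y))
  have hgi' : ∀ i, Integrable fun y => Real.exp (-w i y) • gradient (u i) y := fun i =>
    (htrans i).1.smul_bdd d (huC i).contDiff_gradient.continuous.aestronglyMeasurable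
      (ae_of_all _ fun y => hd _ (huΔ i y))
  have hPc' : ∫ y in Δ, y = volume.real Δ • Pc := by
    rw [hPc, ← measureReal_def, smul_smul, mul_inv_cancel₀ hVpos.ne', one_smul]
  have hbary : ∀ i, ∫ y, Real.exp (-w i y) • gradient u₀ y =
      volume.real Δ • (-(t i / (1 - t i)) • Pc) := by
    intro i
    have h1t : 1 - t i ≠ 0 := (sub_pos.2 (ht i).2).ne'
    have h0 := integral_exp_neg_smul_gradient_eq_zero (hpot i _ le_rfl).contDiff (htrans i).1
      (hpot i _ le_rfl).norm_gradient_le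
    have h1 : ∀ y, Real.exp (-w i y) • gradient (w i) y =
        (1 - t i) • (Real.exp (-w i y) • gradient u₀ y) +
          t i • (Real.exp (-w i y) • gradient (u i) y) := by
      intro y
      rw [hw, gradient_interpolation hu₀C (huC i), smul_add, smul_comm, smul_comm (t i)]
    simp only [h1] at h0
    rw [integral_add ((hgi i).fun_smul _) ((hgi' i).fun_smul _), integral_smul, integral_smul,
      (htrans i).2.2, hPc'] at h0
    rw [(eq_inv_smul_iff₀ h1t).2 (eq_neg_of_add_eq_zero_left h0)]
    match_scalars
    field_simp
  set q := -(T / (1 - T)) • Pc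
  have hint : ∀ r i, ∫ y, Real.exp (-w i y) * (1 + ⟪v r, gradient u₀ y⟫) =
      volume.real Δ * (1 + ⟪v r, -(t i / (1 - t i)) • Pc⟫) := by
    intro r i
    simp only [mul_add, mul_one, ← real_inner_smul_right]
    rw [integral_add (htrans i).1 ((hgi i).const_inner _), (htrans i).2.1, integral_inner (hgi i),
      hbary]
  have hlim : ∀ r, Tendsto (fun i => ∫ y, Real.exp (-w i y) * (1 + ⟪v r, gradient u₀ y⟫)) atTop
      (𝓝 (volume.real Δ * (1 + ⟪v r, q⟫))) := by
    intro r
    simp only [hint]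
    exact ((tendsto_const_nhds.inner
      ((htT.div (htT.const_sub 1) h1T.ne').neg.smul_const Pc)).const_add 1).const_mul _
  have hℓ0 : ∀ r y, 0 ≤ 1 + ⟪v r, gradient u₀ y⟫ := fun r y => by
    linarith [hΔv _ (hu₀Δ y) r]
  have hineq : ∀ r, -1 ≤ ⟪v r, q⟫ := by
    intro r
    have h := ge_of_tendsto' (hlim r) fun i => integral_nonneg fun y =>
      mul_nonneg (Real.exp_pos _).le (hℓ0 r y)
    linarith [nonneg_of_mul_nonneg_right h hVpos]
  have hiff : ∀ r, ⟪v r, q⟫ = -1 ↔ ⟪v r, yinf⟫ = -1 := by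
    intro r
    have h := limit_integral_eq_zero_iff hVpos (fun i y => (Real.exp_pos (-w i y)).le)
      (fun i => (htrans i).1) (fun i => (htrans i).2.1) htight (hℓ0 r)
      (B := 1 + ‖v r‖ * d) (D := 2 * d)
      (fun y => add_le_add le_rfl ((real_inner_le_norm _ _).trans
        (mul_le_mul_of_nonneg_left (hd _ (hu₀Δ y)) (norm_nonneg _)))) (by positivity)
      (one_add_inner_gradient_log_sum_exp_le p c₀ (fun α => hd _ (hpΔ α))
        fun α => hΔv _ (hpΔ α) r)
      (fun i => by
        simp only [mul_add, mul_one, ← real_inner_smul_right]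
        exact (htrans i).1.add ((hgi i).const_inner _))
      ((tendsto_const_nhds.inner hyinf).const_add 1) (hlim r)
    rw [mul_eq_zero, or_iff_right hVpos.ne', add_eq_zero_iff_eq_neg', add_eq_zero_iff_eq_neg'] at h
    exact h
  have hyΔ : yinf ∈ Δ := hΔc.isClosed.mem_of_tendsto hyinf (.of_forall fun i => hu₀Δ _)
  have hyint : yinf ∉ interior Δ :=
    hΔdef ▸ notMem_interior_of_tendsto_gradient_log_sum_exp p c₀ hxinf hyinf
  obtain ⟨r, hr⟩ := exists_inner_eq_neg_one_of_notMem_interior (hΔv _ hyΔ) (hΔfaces ▸ hyint)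
  have hqΔ : q ∈ Δ := by rw [hΔfaces]; exact hineq
  have hqint : q ∉ interior Δ := by
    rw [hΔfaces]
    exact notMem_interior_of_inner_eq_neg_one ((hiff r).2 hr)
  exact ⟨⟨subset_closure hyΔ, hyint⟩, hineq, hiff, subset_closure hqΔ, hqint⟩
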